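/- Let K be a centrally symmetric convex domain centered at the origin and having no corners, and let u : ℤ/6ℤ → ℝ² be a multi-point with each u_j on the boundary of K. Let φ : [t₀,t₁] → SL₂(ℝ) be a C¹ curve, and define σ_j(t) = φ(t)·u_j for j ∈ ℤ/6ℤ. Assume that each σ_j is a regular curve mapping into the boundary of K and that the images σ_j([t₀,t₁]), j ∈ ℤ/6ℤ, together cover the boundary of K. Then K is a hexameral domain: every boundary point of K is a midpoint of a balanced hexagon of K, and all these balanced hexagons have the same area. -/

import Mathlib

open MeasureTheory

noncomputable section

/-- The wedge (cross) product of two planar vectors. -/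
def wedge (v w : ℝ × ℝ) : ℝ := v.1 * w.2 - v.2 * w.1

/-- A centrally symmetric convex domain in the plane. -/
def IsCSCD (K : Set (ℝ × ℝ)) : Prop :=
  Convex ℝ K ∧ IsCompact K ∧ (interior K).Nonempty ∧ K = -K

/-- `L` is a supporting line of `K` at the boundary point `p`. -/
def IsSupportingLineAt (K : Set (ℝ × ℝ)) (p : ℝ × ℝ) (L : Set (ℝ × ℝ)) : Prop :=
  ∃ f : (ℝ × ℝ) →ₗ[ℝ] ℝ, f ≠ 0 ∧ L = {x | f x = f p} ∧ ∀ x ∈ K, f x ≤ f p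

/-- `K` has no corners. -/
def NoCorners (K : Set (ℝ × ℝ)) : Prop :=
  ∀ p ∈ frontier K, ∃! L : Set (ℝ × ℝ), IsSupportingLineAt K p L

/-- `w : ZMod 6 → ℝ × ℝ` lists, in counterclockwise cyclic order, the vertices of
a balanced hexagon of `K`. -/
def IsBalancedHexagon (K : Set (ℝ × ℝ)) (w : ZMod 6 → ℝ × ℝ) : Prop :=
  (∀ j, w (j + 3) = -w j) ∧
  (∀ j, 0 ≤ wedge (w (j + 1) - w j) (w (j + 2) - w (j + 1))) ∧
  K ⊆ convexHull ℝ (Set.range w) ∧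
  (∀ j, midpoint ℝ (w j) (w (j + 1)) ∈ frontier K)

/-- A hexameral domain. -/
def IsHexameral (K : Set (ℝ × ℝ)) : Prop :=
  IsCSCD K ∧ NoCorners K ∧
  (∀ p ∈ frontier K, ∃ w : ZMod 6 → ℝ × ℝ, IsBalancedHexagon K w ∧
    ∃ j, midpoint ℝ (w j) (w (j + 1)) = p) ∧
  (∃ A : ℝ, ∀ w : ZMod 6 → ℝ × ℝ, IsBalancedHexagon K w →
    (volume (convexHull ℝ (Set.range w))).toReal = A)

/-- A multi-point: `u j + u (j+2) + u (j+4) = 0`, `u (j+3) = -u j`, and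
`u j ∧ u (j+2) = √3/2` for all `j`. -/
def IsMultiPoint (u : ZMod 6 → ℝ × ℝ) : Prop :=
  ∀ j, u j + u (j + 2) + u (j + 4) = 0 ∧ u (j + 3) = -u j ∧
    wedge (u j) (u (j + 2)) = Real.sqrt 3 / 2

/-- The action of a 2×2 real matrix on the plane `ℝ × ℝ`. -/
def matAct (M : Matrix (Fin 2) (Fin 2) ℝ) (p : ℝ × ℝ) : ℝ × ℝ :=
  (M 0 0 * p.1 + M 0 1 * p.2, M 1 0 * p.1 + M 1 1 * p.2)

/-- The wedge product with a fixed left factor, as a linear functional. -/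
def wedgeLeft (d : ℝ × ℝ) : (ℝ × ℝ) →ₗ[ℝ] ℝ :=
  d.1 • LinearMap.snd ℝ ℝ ℝ - d.2 • LinearMap.fst ℝ ℝ ℝ

lemma wedgeLeft_apply (d x : ℝ × ℝ) : wedgeLeft d x = wedge d x := by
  simp [wedgeLeft, wedge]

lemma eq_zero_of_wedge_eq_zero {p q x : ℝ × ℝ} (h : wedge p q ≠ 0) (hp : wedge p x = 0)
    (hq : wedge q x = 0) : x = 0 := by
  have h1 : wedge p q * x.1 = 0 := by
    simp only [wedge] at *; linear_combination q.1 * hp - p.1 * hq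
  have h2 : wedge p q * x.2 = 0 := by
    simp only [wedge] at *; linear_combination q.2 * hp - p.2 * hq
  exact Prod.ext ((mul_eq_zero.1 h1).resolve_left h) ((mul_eq_zero.1 h2).resolve_left h)

lemma wedgeLeft_ne_zero {d : ℝ × ℝ} (hd : d ≠ 0) : wedgeLeft d ≠ 0 := by
  intro h
  apply hd
  have h1 := LinearMap.congr_fun h (1, 0)
  have h2 := LinearMap.congr_fun h (0, 1)
  simp only [wedgeLeft_apply, wedge, LinearMap.zero_apply] at h1 h2
  ext <;> simp <;> linarith

lemma IsCSCD.neg_mem {K : Set (ℝ × ℝ)} (hK : IsCSCD K) {x : ℝ × ℝ} (hx : x ∈ K) : -x ∈ K := by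
  rw [hK.2.2.2]; simpa using hx

lemma IsCSCD.frontier_subset {K : Set (ℝ × ℝ)} (hK : IsCSCD K) : frontier K ⊆ K :=
  hK.2.1.isClosed.frontier_subset

lemma IsCSCD.zero_mem_interior {K : Set (ℝ × ℝ)} (hK : IsCSCD K) :
    (0 : ℝ × ℝ) ∈ interior K := by
  obtain ⟨x, hx⟩ := hK.2.2.1
  have hx' : -x ∈ interior K := by
    rw [mem_interior_iff_mem_nhds] at hx ⊢
    have h : Filter.Tendsto (fun y : ℝ × ℝ => -y) (nhds (-x)) (nhds x) := by
      simpa using continuous_neg.tendsto (-x)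
    filter_upwards [h hx] with y hy
    simpa using hK.neg_mem hy
  have := hK.1.interior hx hx' (a := 1 / 2) (b := 1 / 2) (by norm_num) (by norm_num) (by norm_num)
  simpa using this

lemma IsCSCD.eq_zero_of_nonpos {K : Set (ℝ × ℝ)} (hK : IsCSCD K) (f : (ℝ × ℝ) →ₗ[ℝ] ℝ)
    (hf : ∀ x ∈ K, f x ≤ 0) : f = 0 := by
  have key : ∀ v, f v ≤ 0 := by
    intro v
    have hc : Filter.Tendsto (fun ε : ℝ => ε • v) (nhds 0) (nhds 0) := by
      have : Continuous fun ε : ℝ => ε • v := by fun_prop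
      simpa using this.tendsto 0
    have hev := hc.eventually (mem_interior_iff_mem_nhds.1 hK.zero_mem_interior)
    obtain ⟨δ, hδ, h⟩ := Metric.eventually_nhds_iff.1 hev
    have h1 := hf _ (h (y := δ / 2) (by
      rw [Real.dist_eq, sub_zero, abs_of_pos (by positivity)]; linarith))
    rw [map_smul, smul_eq_mul] at h1
    by_contra hv
    push Not at hv
    have : 0 < δ / 2 * f v := by positivity
    linarith
  refine LinearMap.ext fun v => le_antisymm (key v) ?_
  have := key (-v)
  rw [map_neg] at this
  simpa using this

lemma IsCSCD.pos_of_support {K : Set (ℝ × ℝ)} (hK : IsCSCD K) {f : (ℝ × ℝ) →ₗ[ℝ] ℝ}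
    (hf0 : f ≠ 0) {p : ℝ × ℝ} (hf : ∀ x ∈ K, f x ≤ f p) : 0 < f p := by
  by_contra h
  push Not at h
  exact hf0 (hK.eq_zero_of_nonpos f fun x hx => (hf x hx).trans h)

lemma NoCorners.exists_support {K : Set (ℝ × ℝ)} (hnc : NoCorners K) (hK : IsCSCD K)
    {p : ℝ × ℝ} (hp : p ∈ frontier K) :
    ∃ f : (ℝ × ℝ) →ₗ[ℝ] ℝ, f ≠ 0 ∧ 0 < f p ∧ ∀ x ∈ K, f x ≤ f p := by
  obtain ⟨L, ⟨f, hf0, -, hf⟩, -⟩ := hnc p hp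
  exact ⟨f, hf0, hK.pos_of_support hf0 hf, hf⟩

lemma isSupportingLineAt_of_abs_le {K : Set (ℝ × ℝ)} {f : (ℝ × ℝ) →ₗ[ℝ] ℝ} (hf0 : f ≠ 0)
    {p : ℝ × ℝ} (hf : ∀ x ∈ K, |f x| ≤ |f p|) : IsSupportingLineAt K p {x | f x = f p} := by
  rcases le_total 0 (f p) with h | h
  · refine ⟨f, hf0, rfl, fun x hx => ?_⟩
    have := hf x hx
    rw [abs_of_nonneg h] at this
    exact (le_abs_self _).trans this
  · refine ⟨-f, neg_ne_zero.2 hf0, by simp, fun x hx => ?_⟩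
    have := hf x hx
    rw [abs_of_nonpos h] at this
    exact (neg_le_abs _).trans this

lemma NoCorners.eq_of_abs_le {K : Set (ℝ × ℝ)} (hnc : NoCorners K) {p : ℝ × ℝ}
    (hp : p ∈ frontier K) {f g : (ℝ × ℝ) →ₗ[ℝ] ℝ} (hf0 : f ≠ 0) (hg0 : g ≠ 0)
    (hf : ∀ x ∈ K, |f x| ≤ |f p|) (hg : ∀ x ∈ K, |g x| ≤ |g p|) {x : ℝ × ℝ}
    (hx : f x = f p) : g x = g p := by
  have h := (hnc p hp).unique (isSupportingLineAt_of_abs_le hf0 hf)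
    (isSupportingLineAt_of_abs_le hg0 hg)
  have hx' : x ∈ {x | f x = f p} := hx
  rw [h] at hx'
  exact hx'

/-- The half-open triangle with vertices `0`, `p`, `q` without the side joining `0` and `q`. -/
def sectorTriangle (p q : ℝ × ℝ) : Set (ℝ × ℝ) :=
  {x | ∃ a b : ℝ, 0 < a ∧ 0 ≤ b ∧ a + b ≤ 1 ∧ x = a • p + b • q}

lemma exists_mem_sectorTriangle {w : ZMod 6 → ℝ × ℝ} (hw : ∀ j, w (j + 3) = -w j)
    (hS : ∀ j, 0 < wedge (w j) (w (j + 1))) {x : ℝ × ℝ} (hx0 : x ≠ 0)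
    (hx : ∀ j, 0 ≤ wedge (w (j + 1) - w j) (x - w j)) :
    ∃ j, x ∈ sectorTriangle (w j) (w (j + 1)) := by
  have hneg : ∀ j, wedge (w (j + 3)) x = -wedge (w j) x := fun j => by
    rw [hw]; simp only [wedge, Prod.fst_neg, Prod.snd_neg]; ring
  obtain ⟨i, h0, h1⟩ : ∃ i, 0 ≤ wedge (w i) x ∧ wedge (w (i + 1)) x < 0 := by
    by_contra! hcon
    have step3 : ∀ i, 0 ≤ wedge (w i) x → wedge (w i) x = 0 := fun i hi => by
      have h3 := hcon _ (hcon _ (hcon i hi))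
      rw [show i + 1 + 1 + 1 = i + 3 by ring, hneg] at h3
      linarith
    have : ∃ i, 0 ≤ wedge (w i) x := by
      rcases le_total 0 (wedge (w 0) x) with h | h
      · exact ⟨0, h⟩
      · exact ⟨0 + 3, by rw [hneg]; linarith⟩
    obtain ⟨i, hi⟩ := this
    exact hx0 (eq_zero_of_wedge_eq_zero (hS i).ne' (step3 i hi) (step3 _ (hcon i hi)))
  have hSi := hS i
  have hxi := hx i
  refine ⟨i, -wedge (w (i + 1)) x / wedge (w i) (w (i + 1)),
    wedge (w i) x / wedge (w i) (w (i + 1)), div_pos (by linarith) hSi,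
    div_nonneg h0 hSi.le, ?_, ?_⟩
  · rw [← add_div, div_le_one hSi]
    simp only [wedge, Prod.fst_sub, Prod.snd_sub] at *
    linarith
  · have hne := hSi.ne'
    ext
    · simp only [Prod.fst_add, Prod.smul_fst, smul_eq_mul]
      field_simp
      simp only [wedge]; ring
    · simp only [Prod.snd_add, Prod.smul_snd, smul_eq_mul]
      field_simp
      simp only [wedge]; ring

lemma zero_mem_convexHull_range {w : ZMod 6 → ℝ × ℝ} (hw : ∀ j, w (j + 3) = -w j) :
    (0 : ℝ × ℝ) ∈ convexHull ℝ (Set.range w) := by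
  have h := convex_convexHull ℝ (Set.range w) (subset_convexHull ℝ _ ⟨0, rfl⟩)
    (subset_convexHull ℝ _ ⟨0 + 3, rfl⟩) (a := 1 / 2) (b := 1 / 2) (by norm_num) (by norm_num)
    (by norm_num)
  rw [hw] at h
  simpa using h

lemma sectorTriangle_subset_convexHull {w : ZMod 6 → ℝ × ℝ} (hw : ∀ j, w (j + 3) = -w j)
    (j : ZMod 6) : sectorTriangle (w j) (w (j + 1)) ⊆ convexHull ℝ (Set.range w) := by
  rintro x ⟨a, b, ha, hb, hab, rfl⟩
  have h := (convex_convexHull ℝ (Set.range w)).sum_mem (t := Finset.univ)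
    (w := ![a, b, 1 - a - b]) (z := ![w j, w (j + 1), 0]) (by
      intro i _; fin_cases i <;> simp <;> linarith) (by simp [Fin.sum_univ_three]) (by
      intro i _
      fin_cases i
      · exact subset_convexHull ℝ _ ⟨_, rfl⟩
      · exact subset_convexHull ℝ _ ⟨_, rfl⟩
      · exact zero_mem_convexHull_range hw)
  simpa [Fin.sum_univ_three] using h

lemma mem_convexHull_range_of_wedge_nonneg {w : ZMod 6 → ℝ × ℝ} (hw : ∀ j, w (j + 3) = -w j)
    (hS : ∀ j, 0 < wedge (w j) (w (j + 1))) {x : ℝ × ℝ}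
    (hx : ∀ j, 0 ≤ wedge (w (j + 1) - w j) (x - w j)) : x ∈ convexHull ℝ (Set.range w) := by
  rcases eq_or_ne x 0 with rfl | hx0
  · exact zero_mem_convexHull_range hw
  · obtain ⟨j, hj⟩ := exists_mem_sectorTriangle hw hS hx0 hx
    exact sectorTriangle_subset_convexHull hw j hj

lemma exists_isBalancedHexagon {K : Set (ℝ × ℝ)} (hnc : NoCorners K) (hKf : frontier K ⊆ K)
    {U D : ZMod 6 → ℝ × ℝ} (hU3 : ∀ j, U (j + 3) = -U j)
    (hU1 : ∀ j, U (j + 1) = U j + U (j + 2)) (hW : ∀ j, 0 < wedge (U j) (U (j + 2)))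
    (hUK : ∀ j, U j ∈ frontier K) (hD3 : ∀ j, D (j + 3) = -D j)
    (hD1 : ∀ j, D (j + 1) = D j + D (j + 2)) (hD0 : ∀ j, D j ≠ 0)
    (htr : ∀ j, wedge (D j) (U (j + 2)) + wedge (U j) (D (j + 2)) = 0)
    (hs : ∀ j, ∀ x ∈ K, |wedge (D j) x| ≤ |wedge (D j) (U j)|) :
    ∃ w, IsBalancedHexagon K w ∧ ∀ j, midpoint ℝ (w j) (w (j + 1)) = U j := by
  have e11 : ∀ j : ZMod 6, j + 1 + 1 = j + 2 := by decide
  have e12 : ∀ j : ZMod 6, j + 1 + 2 = j + 3 := by decide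
  have e21 : ∀ j : ZMod 6, j + 2 + 1 = j + 3 := by decide
  have e22 : ∀ j : ZMod 6, j + 2 + 2 = j + 1 + 3 := by decide
  have e51 : ∀ j : ZMod 6, j + 5 + 1 = j := by decide
  have e52 : ∀ j : ZMod 6, j + 5 + 2 = j + 1 := by decide
  set κ : ZMod 6 → ℝ := fun j => wedge (U (j + 2)) (D (j + 1)) with hκ
  have κ0 : ∀ j, κ j = wedge (U (j + 2)) (D j + D (j + 2)) := fun j => by simp only [hκ, hD1]
  have κ1 : ∀ j, κ (j + 1) = wedge (D j) (U (j + 2)) := fun j => by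
    have := htr j
    simp only [hκ, e11, e12, hU3]
    simp only [wedge, Prod.fst_neg, Prod.snd_neg] at *
    linarith
  have κ2 : ∀ j, κ (j + 2) = wedge (U j + U (j + 2)) (D j) := fun j => by
    simp only [hκ, e21, e22, hU3, hD3, hU1]
    simp only [wedge, Prod.fst_neg, Prod.snd_neg]
    ring
  have κ3 : ∀ j, κ (j + 3) = κ j := fun j => by
    have h1 : j + 3 + 2 = j + 2 + 3 := by ring
    have h2 : j + 3 + 1 = j + 1 + 3 := by ring
    simp only [hκ, h1, h2, hU3, hD3]
    simp only [wedge, Prod.fst_neg, Prod.snd_neg]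
    ring
  have hq : ∀ j, wedge (D j) (U j) = -(κ (j + 1) + κ (j + 2)) := fun j => by
    rw [κ1, κ2]; simp only [wedge, Prod.fst_add, Prod.snd_add]; ring
  have ineq1 : ∀ j, |κ (j + 1)| ≤ |κ (j + 1) + κ (j + 2)| := fun j => by
    have := hs j (U (j + 2)) (hKf (hUK _))
    rwa [hq, abs_neg, ← κ1] at this
  have ineq2 : ∀ j, |κ (j + 2)| ≤ |κ (j + 1) + κ (j + 2)| := fun j => by
    have := hs j (U (j + 1)) (hKf (hUK _))
    rw [hq, abs_neg, hU1] at this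
    have e : |κ (j + 2)| = |wedge (D j) (U j + U (j + 2))| := by
      rw [κ2, ← abs_neg]
      congr 1
      simp only [wedge]; ring
    rwa [e]
  have sign12 : ∀ j, 0 ≤ κ (j + 1) * κ (j + 2) := fun j => by
    have h1 := sq_le_sq.2 (ineq1 j)
    have h2 := sq_le_sq.2 (ineq2 j)
    nlinarith [sq_nonneg (κ (j + 1) + κ (j + 2))]
  have sign01 : ∀ j, 0 ≤ κ j * κ (j + 1) := fun j => by
    have := sign12 (j + 5)
    rwa [e51, e52] at this
  have hDp : ∀ j, wedge (D (j + 1)) (D (j + 2 + 1)) = wedge (D j) (D (j + 2)) := fun j => by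
    rw [e21, hD1, hD3]; simp only [wedge, Prod.fst_add, Prod.snd_add, Prod.fst_neg, Prod.snd_neg]
    ring
  have hDq : ∀ j, wedge (D j) (U j) ≠ 0 := fun j h => by
    have h2 := hs j (U (j + 2)) (hKf (hUK _))
    rw [h, abs_zero] at h2
    have h2' := abs_nonpos_iff.1 h2
    refine hD0 j (eq_zero_of_wedge_eq_zero (hW j).ne' ?_ ?_)
    · simp only [wedge] at *; linarith
    · simp only [wedge] at *; linarith
  have κne1 : ∀ j, κ (j + 1) ≠ 0 := fun j h => by
    have hDU : wedge (D j) (U (j + 2)) = 0 := by rw [← κ1, h]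
    have hUD : wedge (U j) (D (j + 2)) = 0 := by have := htr j; linarith
    have key := hnc.eq_of_abs_le (hUK (j + 1)) (wedgeLeft_ne_zero (hD0 j))
      (wedgeLeft_ne_zero (hD0 (j + 2))) (x := U (j + 1) + D j) (by
        intro x hx
        have := hs j x hx
        rw [wedgeLeft_apply, wedgeLeft_apply, hU1]
        convert this using 2
        simp only [wedge, Prod.fst_add, Prod.snd_add] at *; linarith) (by
        intro x hx
        have := hs (j + 2) x hx
        rw [wedgeLeft_apply, wedgeLeft_apply, hU1]
        convert this using 2
        simp only [wedge, Prod.fst_add, Prod.snd_add] at *; linarith) (by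
        rw [wedgeLeft_apply, wedgeLeft_apply]
        simp only [wedge, Prod.fst_add, Prod.snd_add]; ring)
    rw [map_add, add_eq_left, wedgeLeft_apply] at key
    have : wedge (D j) (U j) * wedge (D (j + 2)) (U (j + 2)) = 0 := by
      simp only [wedge] at *
      linear_combination (-((U j).1 * (U (j + 2)).2 - (U j).2 * (U (j + 2)).1)) * key
        - ((U j).1 * (D (j + 2)).2 - (U j).2 * (D (j + 2)).1) * hDU
    exact (mul_ne_zero (hDq j) (hDq (j + 2))) this
  have κne : ∀ j, κ j ≠ 0 := fun j => by
    have := κne1 (j + 5)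
    rwa [e51] at this
  have pos01 : ∀ j, 0 < κ j * κ (j + 1) := fun j =>
    lt_of_le_of_ne (sign01 j) (mul_ne_zero (κne _) (κne _)).symm
  have pos12 : ∀ j, 0 < κ (j + 1) * κ (j + 2) := fun j =>
    lt_of_le_of_ne (sign12 j) (mul_ne_zero (κne _) (κne _)).symm
  have pos02 : ∀ j, 0 < κ j * κ (j + 2) := fun j => by
    have := pos01 (j + 2)
    rw [e21, κ3] at this
    linarith
  have Dpos : ∀ j, 0 < wedge (D j) (D (j + 2)) := fun j => by
    have h : wedge (U j) (U (j + 2)) * wedge (D j) (D (j + 2)) =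
        κ j * κ (j + 1) + κ j * κ (j + 2) + κ (j + 1) * κ (j + 2) := by
      have := htr j
      rw [κ0, κ1, κ2]
      simp only [wedge, Prod.fst_add, Prod.snd_add] at *
      linear_combination ((D j).1 * (U (j + 2)).2 - (D j).2 * (U (j + 2)).1) * this
    refine pos_of_mul_pos_right (b := wedge (D j) (D (j + 2))) ?_ (hW j).le
    rw [h]
    linarith [pos01 j, pos12 j, pos02 j]
  set k : ZMod 6 → ℝ := fun j => κ j / wedge (D j) (D (j + 2)) with hk
  have k3 : ∀ j, k (j + 3) = k j := fun j => by
    have h1 : j + 3 + 2 = j + 2 + 3 := by ring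
    simp only [hk, κ3, h1, hD3]
    simp only [wedge, Prod.fst_neg, Prod.snd_neg, neg_mul_neg]
  have kpos : ∀ j, 0 < k j * k (j + 1) := fun j => by
    simp only [hk]
    rw [div_mul_div_comm]
    exact div_pos (pos01 j) (mul_pos (Dpos _) (Dpos _))
  have kq : ∀ j, k j * wedge (D j) (U j) < 0 := fun j => by
    rw [hq]
    have : 0 < κ j * (κ (j + 1) + κ (j + 2)) := by linarith [pos01 j, pos02 j]
    have := div_pos this (Dpos j)
    have e : k j * -(κ (j + 1) + κ (j + 2)) =
        -(κ j * (κ (j + 1) + κ (j + 2)) / wedge (D j) (D (j + 2))) := by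
      simp only [hk]; ring
    linarith
  have hnext : ∀ j, U (j + 1) - k (j + 1) • D (j + 1) = U j + k j • D j := fun j => by
    have hne := (Dpos j).ne'
    have h1 : k (j + 1) = wedge (D j) (U (j + 2)) / wedge (D j) (D (j + 2)) := by
      have h : j + 1 + 2 = j + 2 + 1 := by ring
      simp only [hk]
      rw [h, hDp, κ1]
    have h0 : k j = wedge (U (j + 2)) (D j + D (j + 2)) / wedge (D j) (D (j + 2)) := by
      simp only [hk]; rw [κ0]
    rw [h1, h0, hU1, hD1]
    ext
    · simp only [Prod.fst_add, Prod.fst_sub, Prod.smul_fst, smul_eq_mul]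
      field_simp
      simp only [wedge, Prod.fst_add, Prod.snd_add]; ring
    · simp only [Prod.snd_add, Prod.snd_sub, Prod.smul_snd, smul_eq_mul]
      field_simp
      simp only [wedge, Prod.fst_add, Prod.snd_add]; ring
  have hw3 : ∀ j, U (j + 3) - k (j + 3) • D (j + 3) = -(U j - k j • D j) := fun j => by
    rw [hU3, hD3, k3]; module
  have hedge : ∀ j, U (j + 1) - k (j + 1) • D (j + 1) - (U j - k j • D j) = (2 * k j) • D j :=
    fun j => by rw [hnext]; module
  have hmid : ∀ j, midpoint ℝ (U j - k j • D j) (U (j + 1) - k (j + 1) • D (j + 1)) = U j :=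
    fun j => by rw [hnext, midpoint_sub_add]
  refine ⟨fun j => U j - k j • D j, ⟨hw3, fun j => ?_, fun x hx => ?_, fun j => ?_⟩, hmid⟩
  · have h2 := hedge (j + 1)
    rw [e11] at h2
    simp only [h2, hedge]
    have : wedge ((2 * k j) • D j) ((2 * k (j + 1)) • D (j + 1)) =
        4 * (k j * k (j + 1)) * wedge (D j) (D (j + 2)) := by
      rw [hD1]
      simp only [wedge, Prod.fst_add, Prod.snd_add, Prod.smul_fst, Prod.smul_snd, smul_eq_mul]
      ring
    rw [this]
    exact (mul_pos (mul_pos (by norm_num) (kpos j)) (Dpos j)).le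
  · refine mem_convexHull_range_of_wedge_nonneg hw3 (fun j => ?_) fun j => ?_
    · simp only [hnext]
      have := kq j
      simp only [wedge, Prod.fst_add, Prod.snd_add, Prod.fst_sub, Prod.snd_sub, Prod.smul_fst,
        Prod.smul_snd, smul_eq_mul] at *
      linarith
    · simp only [hedge]
      have h1 := kq j
      have h2 : |k j * wedge (D j) x| ≤ |k j * wedge (D j) (U j)| := by
        rw [abs_mul, abs_mul]
        exact mul_le_mul_of_nonneg_left (hs j x hx) (abs_nonneg _)
      rw [abs_of_neg h1] at h2
      have h3 := (abs_le.1 h2).1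
      simp only [wedge, Prod.fst_sub, Prod.snd_sub, Prod.smul_fst, Prod.smul_snd,
        smul_eq_mul] at *
      linarith
  · simp only [hmid]
    exact hUK j

lemma wedge_le_of_mem_frontier {K : Set (ℝ × ℝ)} (hK : IsCSCD K) (hnc : NoCorners K)
    {p q r : ℝ × ℝ} (hp : p ∈ frontier K) (hq : q ∈ K) (hpq : p + q ∈ K)
    (hr : r ∈ frontier K) (hpr : p + r ∈ frontier K) (hr0 : 0 < wedge p r) :
    wedge p q ≤ wedge p r := by
  by_contra! hlt
  obtain ⟨l, hl0, hl1, hl⟩ : ∃ l : ℝ, 0 < l ∧ l < 1 ∧ wedge p r = l * wedge p q :=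
    ⟨wedge p r / wedge p q, div_pos hr0 (hr0.trans hlt), (div_lt_one (hr0.trans hlt)).2 hlt,
      by rw [div_mul_cancel₀ _ (hr0.trans hlt).ne']⟩
  have hpK := hK.frontier_subset hp
  obtain ⟨m, rfl⟩ : ∃ m : ℝ, r = l • q + m • p := by
    have hne := (hr0.trans hlt).ne'
    refine ⟨wedge r q / wedge p q, ?_⟩
    have h0 : wedge p (r - l • q - (wedge r q / wedge p q) • p) = 0 := by
      simp only [wedge, Prod.fst_sub, Prod.snd_sub, Prod.smul_fst, Prod.smul_snd,
        smul_eq_mul] at *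
      linarith
    have h1 : wedge q (r - l • q - (wedge r q / wedge p q) • p) = 0 := by
      have : wedge q (r - l • q - (wedge r q / wedge p q) • p) =
          -wedge r q + wedge r q / wedge p q * wedge p q := by
        simp only [wedge, Prod.fst_sub, Prod.snd_sub, Prod.smul_fst, Prod.smul_snd, smul_eq_mul]
        ring
      rw [this, div_mul_cancel₀ _ hne]; ring
    have := eq_zero_of_wedge_eq_zero hne h0 h1
    rw [sub_sub, sub_eq_zero] at this
    exact this
  have ha : l • q - (1 - l) • p ∈ K := by
    have := hK.1 hq (hK.neg_mem hpK) hl0.le (sub_nonneg.2 hl1.le) (by ring)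
    rwa [smul_neg, ← sub_eq_add_neg] at this
  have hb : l • q + p ∈ K := by
    have := hK.1 hpq hpK hl0.le (sub_nonneg.2 hl1.le) (by ring)
    convert this using 1
    module
  obtain ⟨f, -, hf0, hf⟩ := hnc.exists_support hK hr
  obtain ⟨g, -, hg0, hg⟩ := hnc.exists_support hK hpr
  have f1 := hf _ (hK.frontier_subset hpr)
  have f2 := hf _ ha
  have f3 := hf _ hq
  have g1 := hg _ (hK.frontier_subset hr)
  have g2 := hg _ hb
  have g3 := hg _ hpq
  simp only [map_add, map_sub, map_smul, smul_eq_mul] at *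
  have hfp : f p < 0 := by
    refine lt_of_le_of_ne (by linarith) fun h => ?_
    simp only [h, mul_zero, add_zero] at hf0 f3
    nlinarith [pos_of_mul_pos_right hf0 hl0.le]
  have hgp : 0 < g p := by
    refine lt_of_le_of_ne (by linarith) fun h => ?_
    simp only [← h, mul_zero, add_zero, zero_add] at hg0 g3
    nlinarith [pos_of_mul_pos_right hg0 hl0.le]
  have m1 : m ≤ l - 1 := by
    by_contra! h
    nlinarith [mul_pos (neg_pos.2 hfp) (sub_pos.2 h)]
  have m2 : 0 ≤ m := by
    by_contra! h
    nlinarith [mul_pos hgp (neg_pos.2 h)]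
  linarith

lemma IsBalancedHexagon.wedge_pos {K : Set (ℝ × ℝ)} (hK : IsCSCD K) (hnc : NoCorners K)
    {w : ZMod 6 → ℝ × ℝ} (hw : IsBalancedHexagon K w) (j : ZMod 6) :
    0 < wedge (w j) (w (j + 1)) := by
  obtain ⟨h3, hT, hKw, hmid⟩ := hw
  have T0 := hT j
  have T1 := hT (j + 1)
  have T2 := hT (j + 2)
  rw [show j + 1 + 1 = j + 2 by ring, show j + 1 + 2 = j + 3 by ring, h3] at T1
  rw [show j + 2 + 1 = j + 3 by ring, show j + 2 + 2 = j + 1 + 3 by ring, h3, h3] at T2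
  have hm := hmid j
  have hrange : ∀ s : Set (ℝ × ℝ), Convex ℝ s → (∀ x ∈ s, -x ∈ s) → w j ∈ s → w (j + 1) ∈ s →
      w (j + 2) ∈ s → K ⊆ s := by
    intro s hs hneg h0 h1 h2
    refine hKw.trans (convexHull_min ?_ hs)
    rintro _ ⟨i, rfl⟩
    have key : ∀ i j : ZMod 6, i = j ∨ i = j + 1 ∨ i = j + 2 ∨ i = j + 3 ∨ i = j + 1 + 3 ∨
        i = j + 2 + 3 := by decide
    rcases key i j with rfl | rfl | rfl | rfl | rfl | rfl
    · exact h0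
    · exact h1
    · exact h2
    · rw [h3]; exact hneg _ h0
    · rw [h3]; exact hneg _ h1
    · rw [h3]; exact hneg _ h2
  generalize w j = p at *
  generalize w (j + 1) = q at *
  generalize w (j + 2) = r at *
  by_contra! hS
  have hA : wedge (q - p) (r - q) = 0 := by
    simp only [wedge, Prod.fst_sub, Prod.snd_sub, Prod.fst_neg, Prod.snd_neg] at *; linarith
  have hC : wedge (q - p) (-p - r) = 0 := by
    simp only [wedge, Prod.fst_sub, Prod.snd_sub, Prod.fst_neg, Prod.snd_neg] at *; linarith
  rcases T1.eq_or_lt with hB | hB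
  · have line : ∀ d : ℝ × ℝ, wedge d p = 0 → wedge d q = 0 → wedge d r = 0 → d = 0 := by
      intro d hp hq hr
      by_contra hd
      have hsub := hrange {x | wedgeLeft d x = 0}
        (convex_hyperplane (wedgeLeft d).isLinear 0)
        (fun x hx => by simpa using hx) (by simpa [wedgeLeft_apply] using hp)
        (by simpa [wedgeLeft_apply] using hq) (by simpa [wedgeLeft_apply] using hr)
      exact wedgeLeft_ne_zero hd (hK.eq_zero_of_nonpos _ fun x hx => (hsub hx).le)
    have hpq : wedge p q = 0 := by
      simp only [wedge, Prod.fst_sub, Prod.snd_sub, Prod.fst_neg, Prod.snd_neg] at *; linarith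
    have hqr : wedge q r = 0 := by
      simp only [wedge, Prod.fst_sub, Prod.snd_sub, Prod.fst_neg, Prod.snd_neg] at *; linarith
    have hpr : wedge p r = 0 := by
      simp only [wedge, Prod.fst_sub, Prod.snd_sub, Prod.fst_neg, Prod.snd_neg] at *; linarith
    have p0 : p = 0 := line p (by simp only [wedge]; ring) hpq hpr
    have q0 : q = 0 := line q (by simp only [wedge] at *; linarith) (by simp only [wedge]; ring) hqr
    have r0 : r = 0 := line r (by simp only [wedge] at *; linarith)
      (by simp only [wedge] at *; linarith) (by simp only [wedge]; ring)
    have := line (1, 0) (by simp [p0, wedge]) (by simp [q0, wedge]) (by simp [r0, wedge])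
    simp at this
  · have hqp : q - p = 0 := by
      refine eq_zero_of_wedge_eq_zero hB.ne' ?_ ?_
      · simp only [wedge] at *; linarith
      · simp only [wedge] at *; linarith
    obtain rfl : q = p := sub_eq_zero.1 hqp
    rw [midpoint_self] at hm
    have hpr : 0 < wedge q r := by
      simp only [wedge, Prod.fst_sub, Prod.snd_sub, Prod.fst_neg, Prod.snd_neg] at *; linarith
    have bound : ∀ d : ℝ × ℝ, |wedge d q| ≤ wedge q r → |wedge d r| ≤ wedge q r →
        ∀ x ∈ K, |wedgeLeft d x| ≤ wedge q r := by
      intro d hq hr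
      have hsub := hrange ({x | wedgeLeft d x ≤ wedge q r} ∩ {x | -wedge q r ≤ wedgeLeft d x})
        ((convex_halfSpace_le (wedgeLeft d).isLinear _).inter
          (convex_halfSpace_ge (wedgeLeft d).isLinear _))
        (fun x hx => by
          simp only [Set.mem_inter_iff, Set.mem_ofPred_eq, map_neg] at *
          constructor <;> linarith)
      simp only [Set.mem_inter_iff, Set.mem_ofPred_eq, wedgeLeft_apply] at hsub
      intro x hx
      have := hsub ⟨(abs_le.1 hq).2, (abs_le.1 hq).1⟩ ⟨(abs_le.1 hq).2, (abs_le.1 hq).1⟩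
        ⟨(abs_le.1 hr).2, (abs_le.1 hr).1⟩ hx
      exact abs_le.2 ⟨this.2, this.1⟩
    have f1 : wedge (q - r) q = wedge q r := by
      simp only [wedge, Prod.fst_sub, Prod.snd_sub]; ring
    have f2 : wedge (q - r) r = wedge q r := by
      simp only [wedge, Prod.fst_sub, Prod.snd_sub]; ring
    have g1 : wedge (q + r) q = -wedge q r := by
      simp only [wedge, Prod.fst_add, Prod.snd_add]; ring
    have g2 : wedge (q + r) r = wedge q r := by
      simp only [wedge, Prod.fst_add, Prod.snd_add]; ring
    have hf0 : q - r ≠ 0 := by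
      intro h
      rw [h] at f1
      simp only [wedge, Prod.fst_zero, Prod.snd_zero] at *; linarith
    have hg0 : q + r ≠ 0 := by
      intro h
      rw [h] at g2
      simp only [wedge, Prod.fst_zero, Prod.snd_zero] at *; linarith
    have key := hnc.eq_of_abs_le hm (wedgeLeft_ne_zero hf0) (wedgeLeft_ne_zero hg0) (x := r)
      (by
        rw [wedgeLeft_apply _ q, f1, abs_of_pos hpr]
        exact bound _ (by rw [f1, abs_of_pos hpr]) (by rw [f2, abs_of_pos hpr]))
      (by
        rw [wedgeLeft_apply _ q, g1, abs_neg, abs_of_pos hpr]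
        exact bound _ (by rw [g1, abs_neg, abs_of_pos hpr]) (by rw [g2, abs_of_pos hpr]))
      (by rw [wedgeLeft_apply, wedgeLeft_apply, f1, f2])
    rw [wedgeLeft_apply, wedgeLeft_apply, g1, g2] at key
    linarith

lemma measurableSet_standard_sectorTriangle :
    MeasurableSet {x : ℝ × ℝ | 0 < x.1 ∧ 0 ≤ x.2 ∧ x.1 + x.2 ≤ 1} := by
  refine (measurableSet_lt measurable_const measurable_fst).inter
    ((measurableSet_le measurable_const measurable_snd).inter
      (measurableSet_le (measurable_fst.add measurable_snd) measurable_const))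

lemma volume_standard_sectorTriangle :
    volume {x : ℝ × ℝ | 0 < x.1 ∧ 0 ≤ x.2 ∧ x.1 + x.2 ≤ 1} = ENNReal.ofReal (1 / 2) := by
  rw [Measure.volume_eq_prod, Measure.prod_apply measurableSet_standard_sectorTriangle]
  have h : ∀ x : ℝ, volume (Prod.mk x ⁻¹' {x : ℝ × ℝ | 0 < x.1 ∧ 0 ≤ x.2 ∧ x.1 + x.2 ≤ 1}) =
      (Set.Ioc (0 : ℝ) 1).indicator (fun x => ENNReal.ofReal (1 - x)) x := by
    intro x
    by_cases hx : x ∈ Set.Ioc (0 : ℝ) 1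
    · have : Prod.mk x ⁻¹' {x : ℝ × ℝ | 0 < x.1 ∧ 0 ≤ x.2 ∧ x.1 + x.2 ≤ 1} =
          Set.Icc 0 (1 - x) := by
        ext y
        simp only [Set.mem_preimage, Set.mem_ofPred_eq, Set.mem_Icc, hx.1, true_and]
        constructor <;> rintro ⟨h1, h2⟩ <;> constructor <;> linarith
      rw [this, Real.volume_Icc, Set.indicator_of_mem hx, sub_zero]
    · have : Prod.mk x ⁻¹' {x : ℝ × ℝ | 0 < x.1 ∧ 0 ≤ x.2 ∧ x.1 + x.2 ≤ 1} = ∅ := by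
        ext y
        simp only [Set.mem_preimage, Set.mem_ofPred_eq, Set.mem_empty_iff_false, iff_false]
        rintro ⟨h1, h2, h3⟩
        exact hx ⟨h1, by linarith⟩
      rw [this, measure_empty, Set.indicator_of_notMem hx]
  simp_rw [h]
  rw [lintegral_indicator measurableSet_Ioc, ← ofReal_integral_eq_lintegral_ofReal]
  · rw [← intervalIntegral.integral_of_le zero_le_one]
    congr 1
    rw [intervalIntegral.integral_sub (by simp) (by simp)]
    simp
    norm_num
  · exact (by fun_prop : Continuous fun x : ℝ => 1 - x).integrableOn_Ioc
  · exact (ae_restrict_iff' measurableSet_Ioc).2 (.of_forall fun x hx => by simpa using hx.2)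

lemma sectorTriangle_eq_image (p q : ℝ × ℝ) : sectorTriangle p q =
    Matrix.toLin (Module.Basis.finTwoProd ℝ) (Module.Basis.finTwoProd ℝ) !![p.1, q.1; p.2, q.2] ''
      {x : ℝ × ℝ | 0 < x.1 ∧ 0 ≤ x.2 ∧ x.1 + x.2 ≤ 1} := by
  have e : ∀ a b : ℝ, Matrix.toLin (Module.Basis.finTwoProd ℝ) (Module.Basis.finTwoProd ℝ)
      !![p.1, q.1; p.2, q.2] (a, b) = a • p + b • q := by
    intro a b
    rw [Matrix.toLin_finTwoProd_apply]
    ext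
    · simp only [Prod.fst_add, Prod.smul_fst, smul_eq_mul]; ring
    · simp only [Prod.snd_add, Prod.smul_snd, smul_eq_mul]; ring
  ext x
  constructor
  · rintro ⟨a, b, ha, hb, hab, rfl⟩
    exact ⟨(a, b), ⟨ha, hb, hab⟩, e a b⟩
  · rintro ⟨⟨a, b⟩, ⟨ha, hb, hab⟩, rfl⟩
    exact ⟨a, b, ha, hb, hab, e a b⟩

lemma volume_sectorTriangle {p q : ℝ × ℝ} (h : 0 < wedge p q) :
    volume (sectorTriangle p q) = ENNReal.ofReal (wedge p q / 2) := by
  rw [sectorTriangle_eq_image, Measure.addHaar_image_linearMap, LinearMap.det_toLin,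
    Matrix.det_fin_two_of, volume_standard_sectorTriangle,
    show p.1 * q.2 - q.1 * p.2 = wedge p q by simp only [wedge]; ring, abs_of_pos h,
    ← ENNReal.ofReal_mul h.le]
  congr 1
  ring

lemma measurableSet_sectorTriangle {p q : ℝ × ℝ} (h : 0 < wedge p q) :
    MeasurableSet (sectorTriangle p q) := by
  have e : sectorTriangle p q =
      {x | wedge q x < 0} ∩ ({x | 0 ≤ wedge p x} ∩ {x | wedge p x - wedge q x ≤ wedge p q}) := by
    ext x
    constructor
    · rintro ⟨a, b, ha, hb, hab, rfl⟩
      have h1 : wedge q (a • p + b • q) = -(a * wedge p q) := by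
        simp only [wedge, Prod.fst_add, Prod.snd_add, Prod.smul_fst, Prod.smul_snd, smul_eq_mul]
        ring
      have h2 : wedge p (a • p + b • q) = b * wedge p q := by
        simp only [wedge, Prod.fst_add, Prod.snd_add, Prod.smul_fst, Prod.smul_snd, smul_eq_mul]
        ring
      simp only [Set.mem_inter_iff, Set.mem_ofPred_eq, h1, h2]
      exact ⟨by linarith [mul_pos ha h], mul_nonneg hb h.le, by nlinarith⟩
    · rintro ⟨h1, h2, h3⟩
      simp only [Set.mem_ofPred_eq] at h1 h2 h3
      have hne := h.ne'
      refine ⟨-wedge q x / wedge p q, wedge p x / wedge p q, div_pos (by linarith) h,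
        div_nonneg h2 h.le, ?_, ?_⟩
      · rw [← add_div, div_le_one h]; linarith
      · ext
        · simp only [Prod.fst_add, Prod.smul_fst, smul_eq_mul]
          field_simp
          simp only [wedge]; ring
        · simp only [Prod.snd_add, Prod.smul_snd, smul_eq_mul]
          field_simp
          simp only [wedge]; ring
  have hc : ∀ d, Measurable (wedge d) := fun d => by unfold wedge; fun_prop
  rw [e]
  exact (measurableSet_lt (hc _) measurable_const).inter
    ((measurableSet_le measurable_const (hc _)).inter
      (measurableSet_le ((hc _).sub (hc _)) measurable_const))

lemma pairwise_disjoint_sectorTriangle {w : ZMod 6 → ℝ × ℝ} (hw : ∀ j, w (j + 3) = -w j)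
    (hS : ∀ j, 0 < wedge (w j) (w (j + 1))) :
    Pairwise (Function.onFun Disjoint fun j => sectorTriangle (w j) (w (j + 1))) := by
  have hr : ∀ j, 0 < wedge (w j) (w (j + 2)) := fun j => by
    have := hS (j + 2)
    rw [show j + 2 + 1 = j + 3 by ring, hw] at this
    simp only [wedge, Prod.fst_neg, Prod.snd_neg] at *
    linarith
  have hneg : ∀ j x, wedge (w (j + 3)) x = -wedge (w j) x := fun j x => by
    rw [hw]; simp only [wedge, Prod.fst_neg, Prod.snd_neg]; ring
  have signs : ∀ j, ∀ x ∈ sectorTriangle (w j) (w (j + 1)),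
      0 ≤ wedge (w j) x ∧ wedge (w (j + 1)) x < 0 ∧ wedge (w (j + 2)) x < 0 := by
    rintro j x ⟨a, b, ha, hb, -, rfl⟩
    have h1 := mul_pos ha (hS j)
    have h2 := mul_nonneg hb (hS j).le
    have h3 := mul_pos ha (hr j)
    have h4 := hS (j + 1)
    rw [show j + 1 + 1 = j + 2 by ring] at h4
    have h4 := mul_nonneg hb h4.le
    simp only [wedge, Prod.fst_add, Prod.snd_add, Prod.smul_fst, Prod.smul_snd, smul_eq_mul] at *
    refine ⟨?_, ?_, ?_⟩ <;> linarith
  have d1 : ∀ j, Disjoint (sectorTriangle (w j) (w (j + 1)))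
      (sectorTriangle (w (j + 1)) (w (j + 1 + 1))) := fun j =>
    Set.disjoint_left.2 fun x hx hy => by
      linarith [(signs _ x hx).2.1, (signs _ x hy).1]
  have d2 : ∀ j, Disjoint (sectorTriangle (w j) (w (j + 1)))
      (sectorTriangle (w (j + 2)) (w (j + 2 + 1))) := fun j =>
    Set.disjoint_left.2 fun x hx hy => by
      linarith [(signs _ x hx).2.2, (signs _ x hy).1]
  have d3 : ∀ j, Disjoint (sectorTriangle (w j) (w (j + 1)))
      (sectorTriangle (w (j + 3)) (w (j + 3 + 1))) := fun j =>
    Set.disjoint_left.2 fun x hx hy => by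
      have h1 := (signs _ x hx).2.1
      have h2 := (signs _ x hy).2.1
      rw [show j + 3 + 1 = j + 1 + 3 by ring, hneg] at h2
      linarith
  intro i j hij
  have key : ∀ i j : ZMod 6, i ≠ j → j = i + 1 ∨ j = i + 2 ∨ j = i + 3 ∨ i = j + 1 ∨ i = j + 2 := by
    decide
  rcases key i j hij with rfl | rfl | rfl | rfl | rfl
  · exact d1 _
  · exact d2 _
  · exact d3 _
  · exact (d1 _).symm
  · exact (d2 _).symm

lemma wedge_sub_nonneg_of_mem_convexHull {w : ZMod 6 → ℝ × ℝ} (hw : ∀ j, w (j + 3) = -w j)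
    (hS : ∀ j, 0 < wedge (w j) (w (j + 1)))
    (hT : ∀ j, 0 ≤ wedge (w (j + 1) - w j) (w (j + 2) - w (j + 1))) {x : ℝ × ℝ}
    (hx : x ∈ convexHull ℝ (Set.range w)) (j : ZMod 6) :
    0 ≤ wedge (w (j + 1) - w j) (x - w j) := by
  have hsub : convexHull ℝ (Set.range w) ⊆
      {x | wedge (w (j + 1) - w j) (w j) ≤ wedgeLeft (w (j + 1) - w j) x} := by
    refine convexHull_min ?_ (convex_halfSpace_ge (wedgeLeft _).isLinear _)
    rintro _ ⟨i, rfl⟩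
    have key : ∀ i j : ZMod 6, i = j ∨ i = j + 1 ∨ i = j + 2 ∨ i = j + 3 ∨ i = j + 1 + 3 ∨
        i = j + 2 + 3 := by decide
    have h0 := hS j
    have h1 := hT j
    have h2 := hT (j + 2)
    rw [show j + 2 + 1 = j + 3 by ring, show j + 2 + 2 = j + 1 + 3 by ring, hw, hw] at h2
    simp only [Set.mem_ofPred_eq, wedgeLeft_apply]
    rcases key i j with rfl | rfl | rfl | rfl | rfl | rfl <;>
      (try rw [hw]) <;>
      simp only [wedge, Prod.fst_sub, Prod.snd_sub, Prod.fst_neg, Prod.snd_neg] at * <;> linarith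
  have := hsub hx
  simp only [Set.mem_ofPred_eq, wedgeLeft_apply] at this
  simp only [wedge, Prod.fst_sub, Prod.snd_sub] at *
  linarith

lemma volume_convexHull_range {w : ZMod 6 → ℝ × ℝ} (hw : ∀ j, w (j + 3) = -w j)
    (hS : ∀ j, 0 < wedge (w j) (w (j + 1)))
    (hT : ∀ j, 0 ≤ wedge (w (j + 1) - w j) (w (j + 2) - w (j + 1))) :
    (volume (convexHull ℝ (Set.range w))).toReal =
      wedge (w 0) (w 1) + wedge (w 1) (w 2) + wedge (w 2) (w 3) := by
  have e : convexHull ℝ (Set.range w) = {0} ∪ ⋃ j, sectorTriangle (w j) (w (j + 1)) := by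
    apply Set.Subset.antisymm
    · intro x hx
      rcases eq_or_ne x 0 with rfl | hx0
      · exact Or.inl rfl
      · exact Or.inr (Set.mem_iUnion.2 (exists_mem_sectorTriangle hw hS hx0
          (wedge_sub_nonneg_of_mem_convexHull hw hS hT hx)))
    · exact Set.union_subset (Set.singleton_subset_iff.2 (zero_mem_convexHull_range hw))
        (Set.iUnion_subset fun j => sectorTriangle_subset_convexHull hw j)
  have hv : volume (convexHull ℝ (Set.range w)) =
      ∑ j : ZMod 6, ENNReal.ofReal (wedge (w j) (w (j + 1)) / 2) := by
    rw [e, measure_congr (union_ae_eq_right_of_ae_eq_empty (ae_eq_empty.2 (measure_singleton _))),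
      measure_iUnion (pairwise_disjoint_sectorTriangle hw hS)
        (fun j => measurableSet_sectorTriangle (hS j)), tsum_fintype]
    exact Finset.sum_congr rfl fun j _ => volume_sectorTriangle (hS j)
  rw [hv, ENNReal.toReal_sum fun j _ => ENNReal.ofReal_ne_top]
  simp_rw [fun j => ENNReal.toReal_ofReal (half_pos (hS j)).le]
  have h6 : ∀ f : ZMod 6 → ℝ, ∑ j, f j = f 0 + f 1 + f 2 + f 3 + f 4 + f 5 :=
    fun f => Fin.sum_univ_six f
  rw [h6]
  have w4 : w 4 = -w 1 := hw 1
  have w5 : w 5 = -w 2 := hw 2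
  have w3 : w 3 = -w 0 := hw 0
  rw [show (0 : ZMod 6) + 1 = 1 by decide, show (1 : ZMod 6) + 1 = 2 by decide,
    show (2 : ZMod 6) + 1 = 3 by decide, show (3 : ZMod 6) + 1 = 4 by decide,
    show (4 : ZMod 6) + 1 = 5 by decide, show (5 : ZMod 6) + 1 = 0 by decide, w3, w4, w5]
  simp only [wedge, Prod.fst_neg, Prod.snd_neg]
  ring

lemma matAct_add (M : Matrix (Fin 2) (Fin 2) ℝ) (p q : ℝ × ℝ) :
    matAct M (p + q) = matAct M p + matAct M q := by
  ext <;> simp only [matAct, Prod.fst_add, Prod.snd_add] <;> ring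

lemma matAct_neg (M : Matrix (Fin 2) (Fin 2) ℝ) (p : ℝ × ℝ) : matAct M (-p) = -matAct M p := by
  ext <;> simp only [matAct, Prod.fst_neg, Prod.snd_neg] <;> ring

lemma wedge_matAct (M : Matrix (Fin 2) (Fin 2) ℝ) (p q : ℝ × ℝ) :
    wedge (matAct M p) (matAct M q) = M.det * wedge p q := by
  simp only [wedge, matAct, Matrix.det_fin_two]; ring

lemma IsMultiPoint.add_one {u : ZMod 6 → ℝ × ℝ} (hu : IsMultiPoint u) (j : ZMod 6) :
    u (j + 1) = u j + u (j + 2) := by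
  have h1 := (hu j).1
  have h2 := (hu (j + 1)).2.1
  rw [show j + 1 + 3 = j + 4 by ring] at h2
  rw [h2] at h1
  exact (add_neg_eq_zero.1 h1).symm

/-- A regular `C¹` curve in the boundary of a symmetric convex domain is tangent to
supporting lines. -/
lemma abs_wedge_derivWithin_le {K : Set (ℝ × ℝ)} (hK : IsCSCD K) (hnc : NoCorners K)
    {a b : ℝ} (hab : a < b) {γ : ℝ → ℝ × ℝ} (hγ : ContDiffOn ℝ 1 γ (Set.Icc a b))
    (hreg : ∀ t ∈ Set.Icc a b, derivWithin γ (Set.Icc a b) t ≠ 0)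
    (hbd : ∀ t ∈ Set.Icc a b, γ t ∈ frontier K) {t : ℝ} (ht : t ∈ Set.Icc a b) {x : ℝ × ℝ}
    (hx : x ∈ K) :
    |wedge (derivWithin γ (Set.Icc a b) t) x| ≤ |wedge (derivWithin γ (Set.Icc a b) t) (γ t)| := by
  have hc := hγ.continuousOn_derivWithin (uniqueDiffOn_Icc hab) le_rfl
  have hint : ∀ s ∈ Set.Ioo a b, |wedge (derivWithin γ (Set.Icc a b) s) x| ≤
      |wedge (derivWithin γ (Set.Icc a b) s) (γ s)| := by
    intro s hs
    have hs' := Set.Ioo_subset_Icc_self hs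
    have hmem := Icc_mem_nhds hs.1 hs.2
    have hd : HasDerivAt γ (derivWithin γ (Set.Icc a b) s) s :=
      ((hγ.differentiableOn one_ne_zero s hs').hasDerivWithinAt).hasDerivAt hmem
    have hne := hreg s hs'
    generalize derivWithin γ (Set.Icc a b) s = d at *
    obtain ⟨f, hf0, hfp, hf⟩ := hnc.exists_support hK (hbd s hs')
    have hfd : f d = 0 := by
      have hmax : IsLocalMax (fun r => LinearMap.toContinuousLinearMap f (γ r)) s := by
        filter_upwards [hmem] with r hr
        exact hf _ (hK.frontier_subset (hbd r hr))
      exact hmax.hasDerivAt_eq_zero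
        ((LinearMap.toContinuousLinearMap f).hasFDerivAt.comp_hasDerivAt s hd)
    have hprop : ∀ y, wedge d (γ s) * f y = wedge d y * f (γ s) := by
      intro y
      have e : wedge d (γ s) • y - wedge d y • γ s = -wedge (γ s) y • d := by
        ext
        · simp only [wedge, Prod.fst_sub, Prod.smul_fst, smul_eq_mul]; ring
        · simp only [wedge, Prod.snd_sub, Prod.smul_snd, smul_eq_mul]; ring
      have := congrArg f e
      simp only [map_sub, map_smul, smul_eq_mul, hfd] at this
      linarith
    have hfx : |f x| ≤ f (γ s) := by
      have := hf _ (hK.neg_mem hx)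
      rw [map_neg] at this
      exact abs_le.2 ⟨by linarith, hf x hx⟩
    have h1 := congrArg abs (hprop x)
    rw [abs_mul, abs_mul, abs_of_pos hfp] at h1
    have h2 := mul_le_mul_of_nonneg_left hfx (abs_nonneg (wedge d (γ s)))
    rw [h1] at h2
    exact le_of_mul_le_mul_right h2 hfp
  have hγc := hγ.continuousOn
  have hF : ContinuousOn (fun s => |wedge (derivWithin γ (Set.Icc a b) s) x|) (Set.Icc a b) := by
    unfold wedge; fun_prop
  have hG : ContinuousOn (fun s => |wedge (derivWithin γ (Set.Icc a b) s) (γ s)|)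
      (Set.Icc a b) := by
    unfold wedge; fun_prop
  exact ContinuousWithinAt.closure_le (by rwa [closure_Ioo hab.ne])
    ((hF t ht).mono Set.Ioo_subset_Icc_self) ((hG t ht).mono Set.Ioo_subset_Icc_self) hint

lemma exists_isBalancedHexagon_of_curve {K : Set (ℝ × ℝ)} (hK : IsCSCD K) (hnc : NoCorners K)
    {a b : ℝ} (hab : a < b) {σ : ZMod 6 → ℝ → ℝ × ℝ}
    (hσ : ∀ j, ContDiffOn ℝ 1 (σ j) (Set.Icc a b)) (hσ3 : ∀ j t, σ (j + 3) t = -σ j t)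
    (hσ1 : ∀ j t, σ (j + 1) t = σ j t + σ (j + 2) t) {c : ℝ} (hc0 : 0 < c)
    (hc : ∀ j, ∀ t ∈ Set.Icc a b, wedge (σ j t) (σ (j + 2) t) = c)
    (hreg : ∀ j, ∀ t ∈ Set.Icc a b, derivWithin (σ j) (Set.Icc a b) t ≠ 0)
    (hbd : ∀ j, ∀ t ∈ Set.Icc a b, σ j t ∈ frontier K) {t : ℝ} (ht : t ∈ Set.Icc a b) :
    ∃ w, IsBalancedHexagon K w ∧ ∀ j, midpoint ℝ (w j) (w (j + 1)) = σ j t := by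
  have hu : UniqueDiffWithinAt ℝ (Set.Icc a b) t := uniqueDiffOn_Icc hab t ht
  have hd : ∀ j, HasDerivWithinAt (σ j) (derivWithin (σ j) (Set.Icc a b) t) (Set.Icc a b) t :=
    fun j => ((hσ j).differentiableOn one_ne_zero t ht).hasDerivWithinAt
  refine exists_isBalancedHexagon hnc hK.frontier_subset (U := fun j => σ j t)
    (D := fun j => derivWithin (σ j) (Set.Icc a b) t) (fun j => hσ3 j t) (fun j => hσ1 j t)
    (fun j => by rw [hc j t ht]; exact hc0) (fun j => hbd j t ht) (fun j => ?_) (fun j => ?_)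
    (fun j => hreg j t ht) (fun j => ?_)
    (fun j x hx => abs_wedge_derivWithin_le hK hnc hab (hσ j) (hreg j) (hbd j) ht hx)
  · rw [show σ (j + 3) = -σ j from funext (hσ3 j)]
    exact (hd j).neg.derivWithin hu
  · rw [show σ (j + 1) = σ j + σ (j + 2) from funext (hσ1 j)]
    exact ((hd j).add (hd (j + 2))).derivWithin hu
  · have hp : ∀ i, HasDerivWithinAt (fun s => (σ i s).1)
        (derivWithin (σ i) (Set.Icc a b) t).1 (Set.Icc a b) t := fun i =>
      (ContinuousLinearMap.fst ℝ ℝ ℝ).hasFDerivAt.comp_hasDerivWithinAt t (hd i)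
    have hq : ∀ i, HasDerivWithinAt (fun s => (σ i s).2)
        (derivWithin (σ i) (Set.Icc a b) t).2 (Set.Icc a b) t := fun i =>
      (ContinuousLinearMap.snd ℝ ℝ ℝ).hasFDerivAt.comp_hasDerivWithinAt t (hd i)
    have h1 := ((hp j).mul (hq (j + 2))).sub ((hq j).mul (hp (j + 2)))
    have h2 := ((hasDerivWithinAt_const t (Set.Icc a b) c).congr (hc j) (hc j t ht))
    have := hu.eq_deriv _ h1 h2
    simp only [wedge]
    linarith

lemma IsBalancedHexagon.volume_eq {K : Set (ℝ × ℝ)} (hK : IsCSCD K) (hnc : NoCorners K)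
    {w : ZMod 6 → ℝ × ℝ} (hw : IsBalancedHexagon K w) {U : ZMod 6 → ℝ × ℝ} {j : ZMod 6}
    (hU1 : U (j + 1) = U j + U (j + 2)) (hW : 0 < wedge (U j) (U (j + 2)))
    (hUK : ∀ i, U i ∈ frontier K) (hj : midpoint ℝ (w 0) (w 1) = U j) :
    (volume (convexHull ℝ (Set.range w))).toReal = 4 * wedge (U j) (U (j + 2)) := by
  have hS := fun j => hw.wedge_pos hK hnc j
  obtain ⟨h3, hT, -, hmid⟩ := hw
  rw [volume_convexHull_range h3 hS hT]
  have w3 : w 3 = -w 0 := h3 0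
  have m2 := hmid 2
  have m1 := hmid 1
  have s0 := hS 0
  have s1 := hS 1
  have s2 := hS 2
  have hUj := hUK (j + 1)
  rw [hU1] at hUj
  rw [show (2 : ZMod 6) + 1 = 3 by decide, w3] at m2 s2
  rw [show (1 : ZMod 6) + 1 = 2 by decide] at m1 s1
  rw [show (0 : ZMod 6) + 1 = 1 by decide] at s0
  have e : wedge (w 0) (w 1) + wedge (w 1) (w 2) + wedge (w 2) (w 3) =
      4 * wedge (U j) (midpoint ℝ (w 2) (-w 0)) := by
    rw [← hj, w3]
    simp only [midpoint_eq_smul_add, wedge, Prod.smul_fst, Prod.smul_snd, Prod.fst_add,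
      Prod.snd_add, Prod.fst_neg, Prod.snd_neg, smul_eq_mul, invOf_eq_inv]
    ring
  have e1 : midpoint ℝ (w 1) (w 2) = U j + midpoint ℝ (w 2) (-w 0) := by
    rw [← hj]
    simp only [midpoint_eq_smul_add, invOf_eq_inv]
    module
  rw [e1] at m1
  have hpos : 0 < wedge (U j) (midpoint ℝ (w 2) (-w 0)) := by
    rw [w3] at e; linarith
  rw [e]
  congr 1
  have hf := hK.frontier_subset
  exact le_antisymm
    (wedge_le_of_mem_frontier hK hnc (hUK j) (hf m2) (hf m1) (hUK _) hUj hW)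
    (wedge_le_of_mem_frontier hK hnc (hUK j) (hf (hUK _)) (hf hUj) m2 m1 hpos)

/-- Let `K` be a centrally symmetric convex domain without corners, `u` a
multi-point on the boundary of `K`, and `φ : [t₀,t₁] → SL₂(ℝ)` a C¹ curve such
that the curves `σ j t = φ t • u j` are regular, map into the boundary of `K`,
and together cover the boundary of `K`.  Then `K` is a hexameral domain. -/
theorem hexameral_of_sl2_curve (K : Set (ℝ × ℝ)) (hK : IsCSCD K) (hnc : NoCorners K)
    (u : ZMod 6 → ℝ × ℝ) (hu : IsMultiPoint u) (hub : ∀ j, u j ∈ frontier K)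
    (t₀ t₁ : ℝ) (ht : t₀ < t₁) (φ : ℝ → Matrix (Fin 2) (Fin 2) ℝ)
    (hdet : ∀ t ∈ Set.Icc t₀ t₁, (φ t).det = 1)
    (hφC1 : ∀ i j : Fin 2, ContDiffOn ℝ 1 (fun t => φ t i j) (Set.Icc t₀ t₁))
    (σ : ZMod 6 → ℝ → ℝ × ℝ) (hσ : ∀ j t, σ j t = matAct (φ t) (u j))
    (hreg : ∀ j, ∀ t ∈ Set.Icc t₀ t₁, derivWithin (σ j) (Set.Icc t₀ t₁) t ≠ 0)
    (hbd : ∀ j, ∀ t ∈ Set.Icc t₀ t₁, σ j t ∈ frontier K)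
    (hcover : frontier K ⊆ ⋃ j : ZMod 6, σ j '' Set.Icc t₀ t₁) :
    IsHexameral K := by
  have h3 : ∀ j t, σ (j + 3) t = -σ j t := fun j t => by
    rw [hσ, hσ, (hu j).2.1, matAct_neg]
  have h1 : ∀ j t, σ (j + 1) t = σ j t + σ (j + 2) t := fun j t => by
    rw [hσ, hσ, hσ, hu.add_one, matAct_add]
  have hc : ∀ j, ∀ t ∈ Set.Icc t₀ t₁, wedge (σ j t) (σ (j + 2) t) = √3 / 2 := fun j t ht => by
    rw [hσ, hσ, wedge_matAct, hdet t ht, one_mul, (hu j).2.2]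
  have hpos : 0 < √3 / 2 := by positivity
  have hsmooth : ∀ j, ContDiffOn ℝ 1 (σ j) (Set.Icc t₀ t₁) := fun j => by
    rw [show σ j = fun t => matAct (φ t) (u j) from funext (hσ j)]
    exact (((hφC1 0 0).mul contDiffOn_const).add ((hφC1 0 1).mul contDiffOn_const)).prodMk
      (((hφC1 1 0).mul contDiffOn_const).add ((hφC1 1 1).mul contDiffOn_const))
  have hcov : ∀ p ∈ frontier K, ∃ j, ∃ t ∈ Set.Icc t₀ t₁, σ j t = p := fun p hp => by
    simpa using hcover hp
  refine ⟨hK, hnc, fun p hp => ?_, 4 * (√3 / 2), fun w hw => ?_⟩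
  · obtain ⟨j, t, htI, rfl⟩ := hcov p hp
    obtain ⟨w, hw, hmid⟩ :=
      exists_isBalancedHexagon_of_curve hK hnc ht hsmooth h3 h1 hpos hc hreg hbd htI
    exact ⟨w, hw, j, hmid j⟩
  · obtain ⟨j, t, htI, hj⟩ := hcov _ (hw.2.2.2 0)
    rw [hw.volume_eq hK hnc (U := fun i => σ i t) (j := j) (h1 j t)
      (by rw [hc j t htI]; exact hpos) (fun i => hbd i t htI) hj.symm, hc j t htI]
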